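/- Fix a real number p ≥ 2 and an integer n ≥ 1, and let φ_n be as defined in the context. Then |r·φ_n'(r)| ≤ p·φ_n(r) for every r ∈ ℝ. -/

import Mathlib

/-- The truncated power function `φ_n`: `φ_n(r) = |r|^p` for `|r| < n`, and the second-order
Taylor extension `n^{p-2} (p(p-1)/2)(|r|-n)² + p n^{p-1}(|r|-n) + n^p` for `|r| ≥ n`. -/
noncomputable def phi (p : ℝ) (n : ℕ) (r : ℝ) : ℝ :=
  if |r| < n then |r| ^ p
  else (n : ℝ) ^ (p - 2) * (p * (p - 1) / 2) * (|r| - n) ^ 2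
      + p * (n : ℝ) ^ (p - 1) * (|r| - n) + (n : ℝ) ^ p

theorem phi_neg (p : ℝ) (n : ℕ) (r : ℝ) : phi p n (-r) = phi p n r := by
  simp [phi]

theorem deriv_phi_neg (p : ℝ) (n : ℕ) (r : ℝ) :
    deriv (phi p n) (-r) = -deriv (phi p n) r := by
  have h := deriv_comp_neg (phi p n) r
  simp only [phi_neg] at h
  rw [h, neg_neg]

theorem phi_of_nonneg_of_lt (p : ℝ) {n : ℕ} {r : ℝ} (h0 : 0 ≤ r) (hr : r < n) :
    phi p n r = r ^ p := by
  rw [phi, abs_of_nonneg h0, if_pos hr]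

theorem phi_of_le (p : ℝ) {n : ℕ} {r : ℝ} (hr : (n : ℝ) ≤ r) :
    phi p n r = (n : ℝ) ^ (p - 2) * (p * (p - 1) / 2) * (r - n) ^ 2
      + p * (n : ℝ) ^ (p - 1) * (r - n) + (n : ℝ) ^ p := by
  rw [phi, abs_of_nonneg (n.cast_nonneg.trans hr), if_neg hr.not_gt]

theorem phi_nonneg {p : ℝ} (hp : 1 ≤ p) (n : ℕ) (r : ℝ) : 0 ≤ phi p n r := by
  unfold phi
  split_ifs with h
  · positivity
  · have h1 : 0 ≤ |r| - n := by linarith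
    have h2 : 0 ≤ p - 1 := by linarith
    positivity

theorem hasDerivAt_phi_of_pos_of_lt (p : ℝ) {n : ℕ} {r : ℝ} (h0 : 0 < r) (hr : r < n) :
    HasDerivAt (phi p n) (p * r ^ (p - 1)) r := by
  refine (Real.hasDerivAt_rpow_const (Or.inl h0.ne')).congr_of_eventuallyEq ?_
  filter_upwards [Ioo_mem_nhds h0 hr] with x hx
  exact phi_of_nonneg_of_lt p hx.1.le hx.2

theorem hasDerivWithinAt_phi_of_le (p : ℝ) {n : ℕ} {r : ℝ} (hr : (n : ℝ) ≤ r) :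
    HasDerivWithinAt (phi p n)
      ((n : ℝ) ^ (p - 2) * (p * (p - 1)) * (r - n) + p * (n : ℝ) ^ (p - 1)) (Set.Ici r) r := by
  have hsub : HasDerivAt (fun x : ℝ => x - n) 1 r := (hasDerivAt_id r).sub_const _
  have h := (((hsub.pow 2).const_mul ((n : ℝ) ^ (p - 2) * (p * (p - 1) / 2))).add
    (hsub.const_mul (p * (n : ℝ) ^ (p - 1)))).add_const ((n : ℝ) ^ p)
  refine (h.hasDerivWithinAt.congr_deriv ?_).congr (fun x hx => ?_) (phi_of_le p hr)
  · norm_num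
    ring
  · exact phi_of_le p (hr.trans hx)

theorem abs_mul_deriv_phi_le_of_pos {p : ℝ} (hp : 2 ≤ p) {n : ℕ} (hn : 1 ≤ n) {r : ℝ}
    (h0 : 0 < r) : |r * deriv (phi p n) r| ≤ p * phi p n r := by
  rcases lt_or_ge r n with hr | hr
  · rw [(hasDerivAt_phi_of_pos_of_lt p h0 hr).deriv, phi_of_nonneg_of_lt p h0.le hr,
      abs_of_nonneg (by positivity), Real.rpow_sub_one h0.ne']
    exact le_of_eq (by field_simp)
  by_cases hd : DifferentiableAt ℝ (phi p n) r
  · have hN : (0 : ℝ) < n := by exact_mod_cast hn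
    have hs : 0 ≤ r - n := by linarith
    have hp1 : 0 ≤ p - 1 := by linarith
    rw [(uniqueDiffWithinAt_Ici r).eq_deriv _ hd.hasDerivAt.hasDerivWithinAt
      (hasDerivWithinAt_phi_of_le p hr), abs_of_nonneg (by positivity), phi_of_le p hr]
    have e1 : (n : ℝ) ^ (p - 1) = (n : ℝ) ^ (p - 2) * n := by
      rw [← Real.rpow_add_one hN.ne']
      ring_nf
    have e2 : (n : ℝ) ^ p = (n : ℝ) ^ (p - 2) * n ^ 2 := by
      rw [← Real.rpow_add_natCast hN.ne']
      norm_num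
    have key : 0 ≤ (n : ℝ) ^ (p - 2) * p * (p - 1) * (p / 2 - 1) * (r - n) ^ 2 := by
      have : 0 ≤ p / 2 - 1 := by linarith
      positivity
    rw [e1, e2]
    linear_combination key
  · rw [deriv_zero_of_not_differentiableAt hd, mul_zero, abs_zero]
    exact mul_nonneg (by linarith) (phi_nonneg (by linarith) n r)

/-- For `p ≥ 2` and `n ≥ 1`, `|r φ_n'(r)| ≤ p φ_n(r)` for every `r ∈ ℝ`. -/
theorem statement9 (p : ℝ) (hp : 2 ≤ p) (n : ℕ) (hn : 1 ≤ n) (r : ℝ) :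
    |r * deriv (phi p n) r| ≤ p * phi p n r := by
  rcases lt_trichotomy r 0 with hr | rfl | hr
  · have h := abs_mul_deriv_phi_le_of_pos hp hn (neg_pos.2 hr)
    rwa [deriv_phi_neg, phi_neg, neg_mul_neg] at h
  · rw [zero_mul, abs_zero]
    exact mul_nonneg (by linarith) (phi_nonneg (by linarith) n 0)
  · exact abs_mul_deriv_phi_le_of_pos hp hn hr
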